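/- Let d_A, d_B ≥ 1 be integers, d = d_A·d_B, and let ρ_init be any density matrix on ℂ^{d_A} ⊗ ℂ^{d_B}. Define Δ_init^{(1)} = sqrt( d·Tr(ρ_init²) − 1 ), and define the root-mean-square distance Δ_rms^{(1)} = sqrt( E_{U ∼ Haar(U(d))} [ ‖Tr_B(U ρ_init U†) − I_{d_A}/d_A‖_2² / ‖I_{d_A}/d_A‖_2² ] ). Then Δ_rms^{(1)} = Δ_init^{(1)} · sqrt( (d_A² − 1) / (d_A² d_B² − 1) ). -/

import Mathlib

/-!
STATEMENT 7: Thermalization of the first moment (Eq. (S-`k=1`) of the paper):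
`Δ_rms^{(1)} = Δ_init^{(1)} · sqrt((d_A²−1)/(d_A²d_B²−1))`.
-/

open MeasureTheory Matrix
open scoped BigOperators ComplexOrder

noncomputable section

/-- Entrywise measurable structure on matrices (the Borel structure). -/
instance matrixMeasurableSpace (m n : Type*) : MeasurableSpace (Matrix m n ℂ) :=
  inferInstanceAs (MeasurableSpace (m → n → ℂ))

namespace DeepTherm

/-- Partial trace over the second tensor factor `ℂ^{d_B}`. -/
def ptraceB {dA dB : ℕ} (M : Matrix (Fin dA × Fin dB) (Fin dA × Fin dB) ℂ) :
    Matrix (Fin dA) (Fin dA) ℂ :=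
  Matrix.of fun a a' => ∑ b, M (a, b) (a', b)

/-- Hilbert–Schmidt (Frobenius, Schatten-2) norm of a matrix. -/
def hsNorm {ι : Type*} [Fintype ι] (A : Matrix ι ι ℂ) : ℝ :=
  Real.sqrt (∑ f, ∑ g, ‖A f g‖ ^ 2)

end DeepTherm

open DeepTherm

namespace DeepTherm

variable {n : Type*} [Fintype n] [DecidableEq n]

/-- The conjugate `U X Uᴴ` of `X` by a unitary `U`. -/
def unitaryConj (X : Matrix n n ℂ) (U : unitaryGroup n ℂ) : Matrix n n ℂ := U.1 * X * (U.1)ᴴ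

/-- The second moment `E[(U X Uᴴ)ᵢⱼ conj (U X Uᴴ)ₖₗ]`. -/
def secondMoment (μ : Measure (unitaryGroup n ℂ)) (X : Matrix n n ℂ) (i j k l : n) : ℂ :=
  ∫ U, unitaryConj X U i j * star (unitaryConj X U k l) ∂μ

theorem measurable_matrix_entry {m : Type*} (i j : m) :
    Measurable fun M : Matrix m m ℂ => M i j :=
  (measurable_pi_apply j).comp (measurable_pi_apply (X := fun _ : m => m → ℂ) i)

theorem measurable_unitary_entry (i j : n) : Measurable fun U : unitaryGroup n ℂ => U.1 i j :=
  (measurable_matrix_entry i j).comp measurable_subtype_coe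

theorem measurable_unitary_mul_left (V : unitaryGroup n ℂ) :
    Measurable fun U : unitaryGroup n ℂ => V * U := by
  refine Measurable.subtype_mk ?_
  refine measurable_pi_iff.2 fun i => measurable_pi_iff.2 fun j => ?_
  simp only [mul_apply]
  exact Finset.measurable_sum _ fun k _ => (measurable_unitary_entry k j).const_mul _

theorem unitaryConj_apply (X : Matrix n n ℂ) (U : unitaryGroup n ℂ) (i j : n) :
    unitaryConj X U i j = ∑ b, (∑ a, U.1 i a * X a b) * star (U.1 j b) := by
  simp [unitaryConj, mul_apply]

theorem measurable_unitaryConj_entry (X : Matrix n n ℂ) (i j : n) :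
    Measurable fun U => unitaryConj X U i j := by
  simp only [unitaryConj_apply]
  refine Finset.measurable_sum _ fun b _ => Measurable.mul ?_ ?_
  · exact Finset.measurable_sum _ fun a _ => (measurable_unitary_entry i a).mul_const _
  · exact (continuous_star.measurable).comp (measurable_unitary_entry j b)

theorem norm_unitaryConj_entry_le (X : Matrix n n ℂ) (U : unitaryGroup n ℂ) (i j : n) :
    ‖unitaryConj X U i j‖ ≤ ∑ b, ∑ a, ‖X a b‖ := by
  have hU : ∀ i j, ‖U.1 i j‖ ≤ 1 := entry_norm_bound_of_unitary U.2
  rw [unitaryConj_apply]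
  refine norm_sum_le_of_le _ fun b _ => ?_
  rw [norm_mul, norm_star]
  refine (mul_le_of_le_one_right (norm_nonneg _) (hU j b)).trans ?_
  refine norm_sum_le_of_le _ fun a _ => ?_
  rw [norm_mul]
  exact mul_le_of_le_one_left (norm_nonneg _) (hU i a)

theorem integrable_unitaryConj_mul_star (μ : Measure (unitaryGroup n ℂ)) [IsFiniteMeasure μ]
    (X : Matrix n n ℂ) (i j k l : n) :
    Integrable (fun U => unitaryConj X U i j * star (unitaryConj X U k l)) μ := by
  refine Integrable.of_bound (C := (∑ b, ∑ a, ‖X a b‖) * ∑ b, ∑ a, ‖X a b‖) ?_ ?_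
  · exact ((measurable_unitaryConj_entry X i j).mul
      ((continuous_star.measurable).comp
        (measurable_unitaryConj_entry X k l))).aestronglyMeasurable
  · refine Filter.Eventually.of_forall fun U => ?_
    rw [norm_mul, norm_star]
    exact mul_le_mul (norm_unitaryConj_entry_le X U i j) (norm_unitaryConj_entry_le X U k l)
      (norm_nonneg _) (by positivity)

/-- Second moments of linear combinations of entries. -/
theorem integral_sum_mul_star_sum (μ : Measure (unitaryGroup n ℂ)) [IsFiniteMeasure μ]
    (X : Matrix n n ℂ) {ι κ : Type*} [Fintype ι] [Fintype κ] (c : ι → ℂ) (f g : ι → n)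
    (c' : κ → ℂ) (f' g' : κ → n) :
    ∫ U, (∑ s, c s * unitaryConj X U (f s) (g s)) *
        star (∑ t, c' t * unitaryConj X U (f' t) (g' t)) ∂μ =
      ∑ s, ∑ t, c s * star (c' t) * secondMoment μ X (f s) (g s) (f' t) (g' t) := by
  have h : ∀ U, (∑ s, c s * unitaryConj X U (f s) (g s)) *
        star (∑ t, c' t * unitaryConj X U (f' t) (g' t)) =
      ∑ s, ∑ t, c s * star (c' t) *
        (unitaryConj X U (f s) (g s) * star (unitaryConj X U (f' t) (g' t))) := by
    intro U
    rw [star_sum, Finset.sum_mul_sum]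
    refine Finset.sum_congr rfl fun s _ => Finset.sum_congr rfl fun t _ => ?_
    rw [star_mul']
    ring
  simp only [h]
  rw [integral_finsetSum _ fun s _ => integrable_finsetSum _ fun t _ =>
    (integrable_unitaryConj_mul_star μ X _ _ _ _).const_mul _]
  refine Finset.sum_congr rfl fun s _ => ?_
  rw [integral_finsetSum _ fun t _ => (integrable_unitaryConj_mul_star μ X _ _ _ _).const_mul _]
  exact Finset.sum_congr rfl fun t _ => integral_const_mul _ _

section Invariance

variable (μ : Measure (unitaryGroup n ℂ)) [μ.IsMulLeftInvariant] (X : Matrix n n ℂ)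

theorem secondMoment_eq_integral_conj (V : unitaryGroup n ℂ) (i j k l : n) :
    secondMoment μ X i j k l =
      ∫ U, (V.1 * unitaryConj X U * (V.1)ᴴ) i j *
        star ((V.1 * unitaryConj X U * (V.1)ᴴ) k l) ∂μ := by
  have h : ∀ U, V.1 * unitaryConj X U * (V.1)ᴴ = unitaryConj X (V * U) := by
    intro U
    simp [unitaryConj, Matrix.mul_assoc]
  have hm := (((measurable_unitaryConj_entry X i j).mul
      ((continuous_star.measurable).comp
        (measurable_unitaryConj_entry X k l))).aestronglyMeasurable
          (μ := Measure.map (fun U => V * U) μ))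
  have := integral_map (measurable_unitary_mul_left V).aemeasurable hm
  rw [map_mul_left_eq_self μ V] at this
  simp only [h]
  exact this

/-- Conjugation by a diagonal matrix of phases. -/
theorem secondMoment_eq_phase_mul (D : n → ℂ) (hD : ∀ i, D i * star (D i) = 1) (i j k l : n) :
    secondMoment μ X i j k l =
      D i * star (D j) * (star (D k) * D l) * secondMoment μ X i j k l := by
  have hV : diagonal D ∈ unitaryGroup n ℂ := by
    rw [mem_unitaryGroup_iff, star_eq_conjTranspose, diagonal_conjTranspose, diagonal_mul_diagonal]
    simp only [Pi.star_apply, hD]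
    exact diagonal_one
  conv_lhs => rw [secondMoment_eq_integral_conj μ X ⟨_, hV⟩]
  rw [secondMoment, ← integral_const_mul]
  congr 1
  ext U
  simp only [diagonal_conjTranspose, mul_diagonal, diagonal_mul, Pi.star_apply, star_mul',
    star_star]
  ring

theorem permMatrix_mem_unitaryGroup (σ : Equiv.Perm n) :
    σ.permMatrix ℂ ∈ unitaryGroup n ℂ := by
  rw [mem_unitaryGroup_iff, star_eq_conjTranspose, conjTranspose_permMatrix, ← permMatrix_mul]
  simp

theorem secondMoment_perm (σ : Equiv.Perm n) (i j k l : n) :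
    secondMoment μ X i j k l = secondMoment μ X (σ i) (σ j) (σ k) (σ l) := by
  rw [secondMoment_eq_integral_conj μ X ⟨_, permMatrix_mem_unitaryGroup σ⟩]
  have h : ∀ Y : Matrix n n ℂ, σ.permMatrix ℂ * Y * (σ.permMatrix ℂ)ᴴ = Y.submatrix σ σ := by
    intro Y
    rw [conjTranspose_permMatrix]
    ext a b
    simp [PEquiv.toMatrix_toPEquiv_mul, PEquiv.mul_toMatrix_toPEquiv, Equiv.Perm.permMatrix,
      Equiv.Perm.inv_def]
  simp only [h, submatrix_apply]
  rfl

/-- The square root `(1 + i)/2 + (1 - i)/2 · P` of the transposition matrix `P`. -/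
def sqrtSwap (i j : n) : Matrix n n ℂ :=
  ((1 + Complex.I) / 2) • (1 : Matrix n n ℂ) +
    ((1 - Complex.I) / 2) • (Equiv.swap i j).permMatrix ℂ

theorem conjTranspose_sqrtSwap {m : Type*} [DecidableEq m] (i j : m) :
    (sqrtSwap i j)ᴴ = ((1 - Complex.I) / 2) • (1 : Matrix m m ℂ) +
      ((1 + Complex.I) / 2) • (Equiv.swap i j).permMatrix ℂ := by
  simp [sqrtSwap, sub_eq_add_neg]

theorem sqrtSwap_mem_unitaryGroup (i j : n) : sqrtSwap i j ∈ unitaryGroup n ℂ := by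
  have hP : (Equiv.swap i j).permMatrix ℂ * (Equiv.swap i j).permMatrix ℂ = 1 := by
    rw [← permMatrix_mul]; simp
  rw [mem_unitaryGroup_iff, star_eq_conjTranspose, conjTranspose_sqrtSwap, sqrtSwap]
  simp only [mul_add, add_mul, smul_mul_smul_comm, mul_one, one_mul, hP]
  have h1 : (1 + Complex.I) / 2 * ((1 - Complex.I) / 2) = 1 / 2 := by
    linear_combination (-1 / 4 : ℂ) * Complex.I_sq
  have h2 : (1 - Complex.I) / 2 * ((1 - Complex.I) / 2) = - (Complex.I / 2) := by
    linear_combination (1 / 4 : ℂ) * Complex.I_sq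
  have h3 : (1 + Complex.I) / 2 * ((1 + Complex.I) / 2) = Complex.I / 2 := by
    linear_combination (1 / 4 : ℂ) * Complex.I_sq
  rw [mul_comm ((1 - Complex.I) / 2) ((1 + Complex.I) / 2), h1, h2, h3]
  module

theorem sqrtSwap_conj_apply (Y : Matrix n n ℂ) (i j : n) :
    (sqrtSwap i j * Y * (sqrtSwap i j)ᴴ) i i =
      (1 / 2) * Y i i + (1 / 2) * Y j j + (Complex.I / 2) * Y i j
        + (-Complex.I / 2) * Y j i := by
  rw [conjTranspose_sqrtSwap, sqrtSwap]
  simp only [mul_add, add_mul, smul_mul_assoc, mul_smul_comm, mul_one, one_mul,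
    Matrix.add_apply, Matrix.smul_apply, smul_eq_mul, Equiv.Perm.permMatrix,
    PEquiv.toMatrix_toPEquiv_mul,
    PEquiv.mul_toMatrix_toPEquiv, submatrix_apply, id, Equiv.symm_swap, Equiv.swap_apply_left]
  linear_combination (-1 / 4 : ℂ) * (Y i i + Y j j - Y i j - Y j i) * Complex.I_sq

theorem secondMoment_eq_zero (i j k l : n) (h₁ : ¬ (i = k ∧ j = l)) (h₂ : ¬ (i = j ∧ k = l)) :
    secondMoment μ X i j k l = 0 := by
  by_contra h0
  have key : ∀ x : n, (Function.update (fun _ => 1) x Complex.I : n → ℂ) i *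
      star ((Function.update (fun _ => 1) x Complex.I : n → ℂ) j) *
      (star ((Function.update (fun _ => 1) x Complex.I : n → ℂ) k) *
        (Function.update (fun _ => 1) x Complex.I : n → ℂ) l) = 1 := by
    intro x
    have := secondMoment_eq_phase_mul μ X (Function.update (fun _ => 1) x Complex.I)
      (fun y => by
        by_cases hy : y = x
        · subst hy; simp
        · simp [hy]) i j k l
    exact (mul_eq_right₀ h0).1 this.symm
  have count : ∀ x : n, (if i = x then 1 else 0) + (if l = x then 1 else 0) =
      (if j = x then 1 else 0) + (if k = x then 1 else 0) := by
    intro x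
    have hx := key x
    simp only [Function.update_apply] at hx
    generalize i = x at hx ⊢
    generalize j = x at hx ⊢
    generalize k = x at hx ⊢
    generalize l = x at hx ⊢
    split_ifs at hx ⊢ <;> first | rfl | (exfalso; revert hx; norm_num [Complex.ext_iff])
  have hi := count i
  have hj := count j
  have hk := count k
  grind

theorem secondMoment_diag [IsFiniteMeasure μ] {i j : n} (hij : i ≠ j) :
    secondMoment μ X i i i i = secondMoment μ X i j i j + secondMoment μ X i i j j := by
  have h := secondMoment_eq_integral_conj μ X ⟨_, sqrtSwap_mem_unitaryGroup i j⟩ i i i i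
  simp only [sqrtSwap_conj_apply] at h
  have h4 := integral_sum_mul_star_sum μ X
    ![1 / 2, 1 / 2, Complex.I / 2, -Complex.I / 2] ![i, j, i, j] ![i, j, j, i]
    ![1 / 2, 1 / 2, Complex.I / 2, -Complex.I / 2] ![i, j, i, j] ![i, j, j, i]
  simp only [Fin.sum_univ_four, Fin.isValue, cons_val] at h4
  rw [h4] at h
  have hp := secondMoment_perm μ X (Equiv.swap i j) j j j j
  have hq := secondMoment_perm μ X (Equiv.swap i j) j i j i
  have hr := secondMoment_perm μ X (Equiv.swap i j) j j i i
  simp only [Equiv.swap_apply_left, Equiv.swap_apply_right] at hp hq hr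
  rw [hp, hq, hr] at h
  simp only [secondMoment_eq_zero μ X i i i j (by grind) (by grind),
    secondMoment_eq_zero μ X i i j i (by grind) (by grind),
    secondMoment_eq_zero μ X j j i j (by grind) (by grind),
    secondMoment_eq_zero μ X j j j i (by grind) (by grind),
    secondMoment_eq_zero μ X i j i i (by grind) (by grind),
    secondMoment_eq_zero μ X i j j j (by grind) (by grind),
    secondMoment_eq_zero μ X j i i i (by grind) (by grind),
    secondMoment_eq_zero μ X j i j j (by grind) (by grind),
    secondMoment_eq_zero μ X i j j i (by grind) (by grind),
    secondMoment_eq_zero μ X j i i j (by grind) (by grind)] at h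
  simp only [star_div₀, star_neg, star_one, star_ofNat, RCLike.star_def, Complex.conj_I] at h
  linear_combination 2 * h - secondMoment μ X i j i j * Complex.I_sq

/-- Invariant second moments are combinations of the two pairings of indices. -/
theorem exists_secondMoment_eq [IsFiniteMeasure μ] :
    ∃ q r : ℂ, ∀ i j k l, secondMoment μ X i j k l =
      (if i = k ∧ j = l then q else 0) + (if i = j ∧ k = l then r else 0) := by
  rcases subsingleton_or_nontrivial n with hn | hn
  · rcases isEmpty_or_nonempty n with he | ⟨⟨a⟩⟩
    · exact ⟨0, 0, fun i => he.elim i⟩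
    · refine ⟨secondMoment μ X a a a a, 0, fun i j k l => ?_⟩
      simp [Subsingleton.elim i a, Subsingleton.elim j a, Subsingleton.elim k a,
        Subsingleton.elim l a]
  obtain ⟨a, b, hab⟩ := exists_pair_ne n
  have hσ : ∀ i j : n, i ≠ j → ∃ σ : Equiv.Perm n, σ i = a ∧ σ j = b := by
    intro i j hij
    refine ⟨(Equiv.swap i a).trans (Equiv.swap (Equiv.swap i a j) b), ?_, by simp⟩
    have : a ≠ Equiv.swap i a j := by
      intro h
      have h2 := congrArg (Equiv.swap i a) h
      simp at h2
      exact hij h2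
    simp [Equiv.swap_apply_of_ne_of_ne this hab]
  have hq : ∀ i j, i ≠ j → secondMoment μ X i j i j = secondMoment μ X a b a b := by
    intro i j hij
    obtain ⟨σ, hi, hj⟩ := hσ i j hij
    rw [secondMoment_perm μ X σ, hi, hj]
  have hr : ∀ i j, i ≠ j → secondMoment μ X i i j j = secondMoment μ X a a b b := by
    intro i j hij
    obtain ⟨σ, hi, hj⟩ := hσ i j hij
    rw [secondMoment_perm μ X σ, hi, hj]
  refine ⟨secondMoment μ X a b a b, secondMoment μ X a a b b, fun i j k l => ?_⟩
  by_cases h₁ : i = k ∧ j = l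
  · obtain ⟨rfl, rfl⟩ := h₁
    by_cases hij : i = j
    · subst hij
      obtain ⟨j, hj⟩ := exists_ne i
      simp [secondMoment_diag μ X hj.symm, hq i j hj.symm, hr i j hj.symm]
    · simp [hij, hq i j hij]
  · by_cases h₂ : i = j ∧ k = l
    · obtain ⟨rfl, rfl⟩ := h₂
      have hik : i ≠ k := fun h => h₁ ⟨h, h⟩
      simp [hik, hr i k hik]
    · simp [h₁, h₂, secondMoment_eq_zero μ X i j k l h₁ h₂]

end Invariance

theorem trace_unitaryConj (X : Matrix n n ℂ) (U : unitaryGroup n ℂ) :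
    (unitaryConj X U).trace = X.trace := by
  rw [unitaryConj, trace_mul_comm, ← Matrix.mul_assoc, ← star_eq_conjTranspose,
    mem_unitaryGroup_iff'.1 U.2, Matrix.one_mul]

theorem unitaryConj_mul_conjTranspose (X : Matrix n n ℂ) (U : unitaryGroup n ℂ) :
    unitaryConj X U * (unitaryConj X U)ᴴ = unitaryConj (X * Xᴴ) U := by
  have h : (U.1)ᴴ * U.1 = 1 := mem_unitaryGroup_iff'.1 U.2
  simp only [unitaryConj, conjTranspose_mul, conjTranspose_conjTranspose]
  calc U.1 * X * (U.1)ᴴ * (U.1 * (Xᴴ * (U.1)ᴴ))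
      = U.1 * X * ((U.1)ᴴ * U.1) * Xᴴ * (U.1)ᴴ := by simp only [Matrix.mul_assoc]
    _ = U.1 * (X * Xᴴ) * (U.1)ᴴ := by rw [h]; simp only [Matrix.mul_assoc, Matrix.one_mul]

theorem sum_mul_star_eq_trace {m : Type*} [Fintype m] (X : Matrix m m ℂ) :
    ∑ i, ∑ j, X i j * star (X i j) = (X * Xᴴ).trace := by
  simp [trace, mul_apply]

section Relations

variable (μ : Measure (unitaryGroup n ℂ)) [IsProbabilityMeasure μ] (X : Matrix n n ℂ)

theorem sum_secondMoment_diag (hX : X.trace = 0) :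
    ∑ i, ∑ k, secondMoment μ X i i k k = 0 := by
  have h := integral_sum_mul_star_sum μ X (fun _ : n => 1) id id (fun _ : n => 1) id id
  simp only [one_mul, star_one, id] at h
  rw [← h]
  have h0 : ∀ U, ∑ i, unitaryConj X U i i = 0 := fun U => (trace_unitaryConj X U).trans hX
  simp [h0]

theorem sum_secondMoment_norm_sq :
    ∑ i, ∑ j, secondMoment μ X i j i j = (X * Xᴴ).trace := by
  have h : ∀ U, ∑ i, ∑ j, unitaryConj X U i j * star (unitaryConj X U i j) =
      (X * Xᴴ).trace := by
    intro U
    rw [sum_mul_star_eq_trace, unitaryConj_mul_conjTranspose, trace_unitaryConj]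
  calc ∑ i, ∑ j, secondMoment μ X i j i j
      = ∫ U, ∑ i, ∑ j, unitaryConj X U i j * star (unitaryConj X U i j) ∂μ := by
        rw [integral_finsetSum _ fun s _ => integrable_finsetSum _ fun t _ =>
          integrable_unitaryConj_mul_star μ X _ _ _ _]
        refine Finset.sum_congr rfl fun i _ => ?_
        rw [integral_finsetSum _ fun t _ => integrable_unitaryConj_mul_star μ X _ _ _ _]
        rfl
    _ = (X * Xᴴ).trace := by simp only [h]; simp

end Relations

section PartialTrace

variable {dA dB : ℕ}

theorem hsNorm_sq {ι : Type*} [Fintype ι] (A : Matrix ι ι ℂ) :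
    hsNorm A ^ 2 = ∑ f, ∑ g, ‖A f g‖ ^ 2 :=
  Real.sq_sqrt (by positivity)

theorem hsNorm_sq_smul_one (hdA : 1 ≤ dA) :
    hsNorm ((dA : ℂ)⁻¹ • (1 : Matrix (Fin dA) (Fin dA) ℂ)) ^ 2 = (dA : ℝ)⁻¹ := by
  have : (dA : ℝ) ≠ 0 := by positivity
  rw [hsNorm_sq]
  simp only [Matrix.smul_apply, Matrix.one_apply, smul_eq_mul, mul_ite, mul_one, mul_zero,
    apply_ite norm, ite_pow, norm_zero, ne_eq, OfNat.ofNat_ne_zero, not_false_eq_true, zero_pow,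
    Finset.sum_ite_eq, Finset.mem_univ, if_true, norm_inv, Complex.norm_natCast,
    Finset.sum_const, Finset.card_univ, Fintype.card_fin, nsmul_eq_mul]
  field_simp

theorem ptraceB_unitaryConj_sub (hdA : 1 ≤ dA) (hdB : 1 ≤ dB)
    (ρ : Matrix (Fin dA × Fin dB) (Fin dA × Fin dB) ℂ)
    (U : unitaryGroup (Fin dA × Fin dB) ℂ) :
    ptraceB (U.1 * ρ * (U.1)ᴴ) - (dA : ℂ)⁻¹ • (1 : Matrix (Fin dA) (Fin dA) ℂ) =
      ptraceB (unitaryConj (ρ - ((dA : ℂ) * dB)⁻¹ • 1) U) := by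
  have h : U.1 * (U.1)ᴴ = 1 := mem_unitaryGroup_iff.1 U.2
  have hB : (dB : ℂ) ≠ 0 := by exact_mod_cast (by omega : dB ≠ 0)
  have h2 : unitaryConj (ρ - ((dA : ℂ) * dB)⁻¹ • 1) U =
      U.1 * ρ * (U.1)ᴴ - ((dA : ℂ) * dB)⁻¹ • 1 := by
    simp [unitaryConj, Matrix.mul_sub, Matrix.sub_mul, h]
  rw [h2]
  ext a a'
  by_cases haa : a = a'
  · subst haa
    simp [ptraceB, Finset.sum_sub_distrib]
    field_simp
  · simp [ptraceB, haa]

/-- The mean square Hilbert–Schmidt norm of the partial trace of a randomly conjugated traceless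
matrix. -/
theorem integral_hsNorm_sq_ptraceB (hdA : 1 ≤ dA) (hdB : 1 ≤ dB)
    (μ : Measure (unitaryGroup (Fin dA × Fin dB) ℂ))
    [IsProbabilityMeasure μ] [μ.IsMulLeftInvariant]
    (X : Matrix (Fin dA × Fin dB) (Fin dA × Fin dB) ℂ) (hX : X.trace = 0) :
    ((∫ U, hsNorm (ptraceB (unitaryConj X U)) ^ 2 ∂μ : ℝ) : ℂ) =
      dB * ((dA : ℂ) ^ 2 - 1) / ((dA : ℂ) ^ 2 * (dB : ℂ) ^ 2 - 1) * (X * Xᴴ).trace := by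
  have hA : (dA : ℂ) ≠ 0 := by exact_mod_cast (by omega : dA ≠ 0)
  have hB : (dB : ℂ) ≠ 0 := by exact_mod_cast (by omega : dB ≠ 0)
  obtain ⟨q, r, hqr⟩ := exists_secondMoment_eq μ X
  have hzero := sum_secondMoment_diag μ X hX
  have hfrob := sum_secondMoment_norm_sq μ X
  have hint : ((∫ U, hsNorm (ptraceB (unitaryConj X U)) ^ 2 ∂μ : ℝ) : ℂ) =
      ∑ a, ∑ a', ∑ b, ∑ b', secondMoment μ X (a, b) (a', b) (a, b') (a', b') := by
    rw [← integral_complex_ofReal]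
    have hpt : ∀ U, ((hsNorm (ptraceB (unitaryConj X U)) ^ 2 : ℝ) : ℂ) =
        ∑ a, ∑ a', ∑ b, ∑ b', unitaryConj X U (a, b) (a', b) *
          star (unitaryConj X U (a, b') (a', b')) := by
      intro U
      rw [hsNorm_sq]
      push_cast
      refine Finset.sum_congr rfl fun a _ => Finset.sum_congr rfl fun a' _ => ?_
      rw [← Complex.mul_conj']
      simp [ptraceB, Finset.sum_mul_sum]
    simp only [hpt]
    have hI := fun a b c d => integrable_unitaryConj_mul_star μ X a b c d
    rw [integral_finsetSum _ fun _ _ => integrable_finsetSum _ fun _ _ =>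
      integrable_finsetSum _ fun _ _ => integrable_finsetSum _ fun _ _ => hI _ _ _ _]
    refine Finset.sum_congr rfl fun a _ => ?_
    rw [integral_finsetSum _ fun _ _ => integrable_finsetSum _ fun _ _ =>
      integrable_finsetSum _ fun _ _ => hI _ _ _ _]
    refine Finset.sum_congr rfl fun a' _ => ?_
    rw [integral_finsetSum _ fun _ _ => integrable_finsetSum _ fun _ _ => hI _ _ _ _]
    refine Finset.sum_congr rfl fun b _ => ?_
    rw [integral_finsetSum _ fun _ _ => hI _ _ _ _]
    rfl
  rw [hint]
  simp only [hqr] at hzero hfrob ⊢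
  simp only [Finset.sum_add_distrib, Prod.mk.injEq, and_self, and_true, true_and, Finset.sum_ite_eq,
    Finset.mem_univ, if_true, Finset.sum_const, Finset.card_univ, Fintype.card_prod,
    Fintype.card_fin, nsmul_eq_mul, mul_ite, mul_zero, Nat.cast_mul] at hzero hfrob ⊢
  rw [← hfrob]
  have hr : r = -q / (dA * dB) := by
    rw [eq_div_iff (mul_ne_zero hA hB)]
    apply mul_left_cancel₀ (mul_ne_zero hA hB)
    linear_combination hzero
  rw [hr]
  by_cases h1 : (dA : ℂ) ^ 2 * (dB : ℂ) ^ 2 - 1 = 0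
  · have h2 : (dA * dB) ^ 2 = 1 := by
      have : (((dA * dB) ^ 2 : ℕ) : ℂ) = (1 : ℕ) := by
        push_cast
        linear_combination h1
      exact_mod_cast this
    obtain ⟨rfl, rfl⟩ := mul_eq_one.1 ((Nat.pow_eq_one.1 h2).resolve_right two_ne_zero)
    simp
  · field_simp
    ring

end PartialTrace

end DeepTherm

/-- For any density matrix `ρ_init` on `ℂ^{d_A} ⊗ ℂ^{d_B}`, with
`Δ_init^{(1)} = sqrt(d·Tr(ρ_init²) − 1)` and
`Δ_rms^{(1)} = sqrt(E_{U∼Haar} ‖Tr_B(U ρ_init U†) − I/d_A‖₂² / ‖I/d_A‖₂²)`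
(Haar = the left-invariant Borel probability measure on the unitary group),
one has `Δ_rms^{(1)} = Δ_init^{(1)} · sqrt((d_A²−1)/(d_A²d_B²−1))`. -/
theorem statement7 (dA dB : ℕ) (hdA : 1 ≤ dA) (hdB : 1 ≤ dB)
    (ρ : Matrix (Fin dA × Fin dB) (Fin dA × Fin dB) ℂ)
    (hρ : ρ.PosSemidef) (htr : ρ.trace = 1)
    (μ : Measure (Matrix.unitaryGroup (Fin dA × Fin dB) ℂ))
    [IsProbabilityMeasure μ] [μ.IsMulLeftInvariant] :
    Real.sqrt (∫ U,
        hsNorm (ptraceB (U.1 * ρ * (U.1)ᴴ) - (dA : ℂ)⁻¹ • (1 : Matrix (Fin dA) (Fin dA) ℂ)) ^ 2 /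
          hsNorm ((dA : ℂ)⁻¹ • (1 : Matrix (Fin dA) (Fin dA) ℂ)) ^ 2 ∂μ) =
      Real.sqrt (((dA : ℝ) * (dB : ℝ)) * ((ρ * ρ).trace).re - 1) *
        Real.sqrt (((dA : ℝ) ^ 2 - 1) / ((dA : ℝ) ^ 2 * (dB : ℝ) ^ 2 - 1)) := by
  have hA : (dA : ℂ) ≠ 0 := by exact_mod_cast (by omega : dA ≠ 0)
  have hB : (dB : ℂ) ≠ 0 := by exact_mod_cast (by omega : dB ≠ 0)
  have hA' : (1 : ℝ) ≤ dA := by exact_mod_cast hdA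
  have hB' : (1 : ℝ) ≤ dB := by exact_mod_cast hdB
  have hX : (ρ - ((dA : ℂ) * dB)⁻¹ • 1).trace = 0 := by
    simp [trace_sub, htr]
    field_simp
    ring
  have hS : ((ρ - ((dA : ℂ) * dB)⁻¹ • 1) * (ρ - ((dA : ℂ) * dB)⁻¹ • 1)ᴴ).trace =
      (ρ * ρ).trace - ((dA : ℂ) * dB)⁻¹ := by
    simp [Matrix.mul_sub, Matrix.sub_mul, trace_sub, htr, hρ.1.eq]
    field_simp
    simp
  have hJ := congrArg Complex.re (integral_hsNorm_sq_ptraceB hdA hdB μ _ hX)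
  have hc : (dB * ((dA : ℂ) ^ 2 - 1) / ((dA : ℂ) ^ 2 * (dB : ℂ) ^ 2 - 1)) =
      ((dB * ((dA : ℝ) ^ 2 - 1) / ((dA : ℝ) ^ 2 * (dB : ℝ) ^ 2 - 1) : ℝ) : ℂ) := by
    push_cast
    rfl
  have hd : ((dA : ℂ) * dB)⁻¹ = (((dA : ℝ) * dB)⁻¹ : ℝ) := by
    push_cast
    rfl
  rw [hS, hc, Complex.re_ofReal_mul, Complex.ofReal_re, Complex.sub_re, hd,
    Complex.ofReal_re] at hJ
  simp only [ptraceB_unitaryConj_sub hdA hdB, hsNorm_sq_smul_one hdA]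
  rw [integral_div, hd, hJ, ← Real.sqrt_mul']
  · congr 1
    field_simp
  · have h1 : (1 : ℝ) ≤ (dA : ℝ) ^ 2 := one_le_pow₀ hA'
    have h2 : (1 : ℝ) ≤ (dB : ℝ) ^ 2 := one_le_pow₀ hB'
    exact div_nonneg (by linarith) (by nlinarith)
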